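/- arXiv:2308.11868 — 2 statements merged into one kernel-verified Lean document; each statement's English description precedes it below -/
import Mathlib

section
/- Let (v_n)_{n≥1} be a sequence in (0,1) and v ∈ (0,1). Assume that (1/n)·Σ_{k=1}^{n} log(1 − v_k) converges to some μ < 0 and that log(v_n)/n → 0 as n → ∞. Let w_n be the stick-breaking weights of (v_n) and w'_n = v(1−v)^{n−1} the geometric weights of v. Then the series Σ_{n≥1} w_n·log(w_n/w'_n) converges absolutely, and Σ_{n≥1} w_n·log(w_n/w'_n) = Σ_{n≥1} (∏_{k<n}(1 − v_k))·d(v_n‖v). -/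
open MeasureTheory ProbabilityTheory Filter Topology

/-- The Beta(a,b) distribution on ℝ, given by its density
`x^(a-1) (1-x)^(b-1) / B(a,b)` on `(0,1)`, where `B(a,b) = Γ(a)Γ(b)/Γ(a+b)`. -/
noncomputable def betaMeasure (a b : ℝ) : Measure ℝ :=
  (volume.restrict (Set.Ioo (0:ℝ) 1)).withDensity
    fun x => ENNReal.ofReal (x ^ (a - 1) * (1 - x) ^ (b - 1) /
      (Real.Gamma a * Real.Gamma b / Real.Gamma (a + b)))

/-- The binary Kullback–Leibler divergence
`d(p‖q) = p log(p/q) + (1-p) log((1-p)/(1-q))`. -/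
noncomputable def binKL (p q : ℝ) : ℝ :=
  p * Real.log (p / q) + (1 - p) * Real.log ((1 - p) / (1 - q))

/-- The digamma function, the logarithmic derivative of the Gamma function. -/
noncomputable def digamma (x : ℝ) : ℝ := deriv (fun y => Real.log (Real.Gamma y)) x


open Asymptotics in
/-- If the ratio of a real sequence to `n` converges, the sequence is `O(n)`. -/
theorem isBigO_natCast_of_tendsto_div {f : ℕ → ℝ} {c : ℝ}
    (h : Tendsto (fun n : ℕ => f n / (n : ℝ)) atTop (𝓝 c)) :
    f =O[atTop] (fun n : ℕ => (n : ℝ)) := by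
  refine isBigO_of_div_tendsto_nhds ?_ c h
  filter_upwards [eventually_gt_atTop 0] with n hn hn0
  exact absurd (Nat.cast_eq_zero.1 hn0) hn.ne'

open Asymptotics in
/-- If `S n / n` converges to a negative limit and `f = O(n)`, then `exp (S n) * f n` is
summable. -/
theorem summable_exp_mul_of_tendsto_div_neg {S f : ℕ → ℝ} {μ : ℝ} (hμ : μ < 0)
    (hS : Tendsto (fun n : ℕ => S n / (n : ℝ)) atTop (𝓝 μ))
    (hf : f =O[atTop] (fun n : ℕ => (n : ℝ))) :
    Summable (fun n => Real.exp (S n) * f n) := by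
  have hexp : (fun n => Real.exp (S n)) =O[atTop] (fun n : ℕ => Real.exp (μ / 2) ^ n) := by
    refine IsBigO.of_bound 1 ?_
    filter_upwards [hS.eventually_lt_const (show μ < μ / 2 by linarith),
      eventually_gt_atTop 0] with n hn hn0
    have hn0' : (0 : ℝ) < n := Nat.cast_pos.2 hn0
    rw [div_lt_iff₀ hn0'] at hn
    rw [one_mul, Real.norm_of_nonneg (Real.exp_pos _).le, Real.norm_of_nonneg (by positivity),
      ← Real.exp_nat_mul]
    exact Real.exp_le_exp.2 (by linarith)
  have hgeom : Summable (fun n : ℕ => (n : ℝ) ^ 1 * Real.exp (μ / 2) ^ n) := by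
    refine summable_pow_mul_geometric_of_norm_lt_one 1 ?_
    rw [Real.norm_of_nonneg (Real.exp_pos _).le]
    exact Real.exp_zero ▸ Real.exp_lt_exp.2 (by linarith)
  refine summable_of_isBigO_nat hgeom ?_
  simpa only [pow_one, mul_comm] using hexp.mul hf

/-- One step of the summation by parts relating the two sides of the decomposition, with
`P = exp S` and `D = S - n log (1 - q)`. -/
theorem exp_mul_binKL_eq {p q : ℝ} (hp : p ∈ Set.Ioo (0 : ℝ) 1) (hq : q ∈ Set.Ioo (0 : ℝ) 1)
    (S : ℝ) (n : ℕ) :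
    Real.exp S * binKL p q =
      p * Real.exp S * Real.log (p * Real.exp S / (q * (1 - q) ^ n)) +
        (Real.exp (S + Real.log (1 - p)) *
            (S + Real.log (1 - p) - ((n + 1 : ℕ) : ℝ) * Real.log (1 - q)) -
          Real.exp S * (S - (n : ℝ) * Real.log (1 - q))) := by
  obtain ⟨hp0, hp1⟩ := hp
  obtain ⟨hq0, hq1⟩ := hq
  have hp' : 0 < 1 - p := sub_pos.2 hp1
  have hq' : 0 < 1 - q := sub_pos.2 hq1
  rw [binKL, Real.log_div hp0.ne' hq0.ne', Real.log_div hp'.ne' hq'.ne',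
    Real.log_div (by positivity) (by positivity), Real.log_mul hp0.ne' (Real.exp_pos S).ne',
    Real.log_mul hq0.ne' (by positivity), Real.log_pow, Real.log_exp, Real.exp_add,
    Real.exp_log hp']
  push_cast
  ring

open Asymptotics in
/-- The decomposition for a sequence indexed from `0`, with `S` the partial sums of
`log (1 - x k)`. -/
theorem kl_decomposition_exp {x S : ℕ → ℝ} {q μ : ℝ} (hx : ∀ n, x n ∈ Set.Ioo (0 : ℝ) 1)
    (hq : q ∈ Set.Ioo (0 : ℝ) 1) (hμ : μ < 0) (hS0 : S 0 = 0)
    (hS : ∀ n, S (n + 1) = S n + Real.log (1 - x n))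
    (hmean : Tendsto (fun n : ℕ => S n / (n : ℝ)) atTop (𝓝 μ))
    (hlog : (fun n => Real.log (x n)) =O[atTop] (fun n : ℕ => (n : ℝ))) :
    Summable (fun n => x n * Real.exp (S n) *
      Real.log (x n * Real.exp (S n) / (q * (1 - q) ^ n))) ∧
    ∑' n, x n * Real.exp (S n) * Real.log (x n * Real.exp (S n) / (q * (1 - q) ^ n)) =
      ∑' n, Real.exp (S n) * binKL (x n) q := by
  have hq' : 0 < 1 - q := sub_pos.2 hq.2
  have hone : (fun _ : ℕ => Real.log q) =O[atTop] (fun n : ℕ => (n : ℝ)) :=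
    isBigO_natCast_of_tendsto_div (tendsto_const_div_atTop_nhds_zero_nat _)
  have hD : (fun n => S n - (n : ℝ) * Real.log (1 - q)) =O[atTop] (fun n : ℕ => (n : ℝ)) := by
    refine (isBigO_natCast_of_tendsto_div hmean).sub ?_
    simpa only [mul_comm] using
      (isBigO_refl (fun n : ℕ => (n : ℝ)) atTop).const_mul_left (Real.log (1 - q))
  have hlogw : (fun n => Real.log (x n * Real.exp (S n) / (q * (1 - q) ^ n)))
      =O[atTop] (fun n : ℕ => (n : ℝ)) := by
    refine ((hlog.sub hone).add hD).congr_left fun n => ?_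
    have := (hx n).1
    have := hq.1
    rw [Real.log_div (by positivity) (by positivity), Real.log_mul (by positivity) (by positivity),
      Real.log_mul (by positivity) (by positivity), Real.log_pow, Real.log_exp]
    ring
  have hx1 : x =O[atTop] (fun _ : ℕ => (1 : ℝ)) := by
    refine IsBigO.of_bound 1 (Eventually.of_forall fun n => ?_)
    rw [Real.norm_of_nonneg (hx n).1.le, norm_one, one_mul]
    exact (hx n).2.le
  have ht : Summable (fun n => x n * Real.exp (S n) *
      Real.log (x n * Real.exp (S n) / (q * (1 - q) ^ n))) := by
    refine (summable_exp_mul_of_tendsto_div_neg hμ hmean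
      (by simpa only [one_mul] using hx1.mul hlogw)).congr fun n => ?_
    ring
  have hG := summable_exp_mul_of_tendsto_div_neg hμ hmean hD
  refine ⟨ht, ?_⟩
  have hG1 := (summable_nat_add_iff 1).2 hG
  have hsplit : ∀ n, Real.exp (S n) * binKL (x n) q = _ :=
    fun n => exp_mul_binKL_eq (hx n) hq (S n) n
  simp only [← hS] at hsplit
  rw [tsum_congr hsplit, ht.tsum_add (hG1.sub hG), hG1.tsum_sub hG, hG.tsum_eq_zero_add, hS0]
  simp

/-- Deterministic version of the Kullback–Leibler decomposition: if `(v_n)_{n≥1} ⊆ (0,1)`,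
`v ∈ (0,1)`, the Cesàro means of `log(1 - v_k)` converge to some `μ < 0`, and
`log(v_n)/n → 0`, then the series `∑_{n≥1} w_n log(w_n / w'_n)` (with `w_n` the
stick-breaking weights of `(v_n)` and `w'_n = v (1-v)^{n-1}` the geometric weights)
converges absolutely and equals `∑_{n≥1} (∏_{k<n} (1 - v_k)) d(v_n ‖ v)`. -/
theorem kl_decomposition_deterministic
    (v : ℕ → ℝ) (hv : ∀ n, 1 ≤ n → v n ∈ Set.Ioo (0:ℝ) 1)
    (vg : ℝ) (hvg : vg ∈ Set.Ioo (0:ℝ) 1)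
    (μ : ℝ) (hμ : μ < 0)
    (hmean : Tendsto
      (fun n : ℕ => (1 / (n:ℝ)) * ∑ k ∈ Finset.Icc 1 n, Real.log (1 - v k))
      atTop (nhds μ))
    (hlog : Tendsto (fun n : ℕ => Real.log (v n) / (n:ℝ)) atTop (nhds 0))
    (w w' : ℕ → ℝ)
    (hw : ∀ n, 1 ≤ n → w n = v n * ∏ j ∈ Finset.Ico 1 n, (1 - v j))
    (hw' : ∀ n, 1 ≤ n → w' n = vg * (1 - vg) ^ (n - 1)) :
    Summable (fun n : ℕ => |w (n + 1) * Real.log (w (n + 1) / w' (n + 1))|) ∧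
    ∑' n : ℕ, w (n + 1) * Real.log (w (n + 1) / w' (n + 1)) =
      ∑' n : ℕ, (∏ k ∈ Finset.Ico 1 (n + 1), (1 - v k)) * binKL (v (n + 1)) vg := by
  have hx : ∀ n, v (n + 1) ∈ Set.Ioo (0 : ℝ) 1 := fun n => hv _ n.succ_pos
  set S : ℕ → ℝ := fun n => ∑ k ∈ Finset.Icc 1 n, Real.log (1 - v k) with hSdef
  have hP : ∀ n, ∏ k ∈ Finset.Ico 1 (n + 1), (1 - v k) = Real.exp (S n) := by
    intro n
    rw [hSdef, Real.exp_sum]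
    refine Finset.prod_congr (by ext; simp) fun k hk => ?_
    rw [Real.exp_log (sub_pos.2 (hv k (Finset.mem_Icc.1 hk).1).2)]
  have hlog' : (fun n => Real.log (v (n + 1))) =O[atTop] (fun n : ℕ => (n : ℝ)) := by
    refine ((isBigO_natCast_of_tendsto_div hlog).comp_tendsto (tendsto_add_atTop_nat 1)).trans ?_
    refine Asymptotics.IsBigO.of_bound 2 ?_
    filter_upwards [eventually_ge_atTop 1] with n hn
    have : (1 : ℝ) ≤ n := by exact_mod_cast hn
    simp only [Function.comp_apply, RCLike.norm_natCast]
    push_cast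
    linarith
  obtain ⟨hsum, heq⟩ := kl_decomposition_exp (x := fun n => v (n + 1)) (S := S) hx hvg hμ
    (by simp [hSdef]) (fun n => Finset.sum_Icc_succ_top (by omega) _)
    (hmean.congr fun n => one_div_mul_eq_div _ _) hlog'
  have hw1 : ∀ n, w (n + 1) = v (n + 1) * Real.exp (S n) := fun n => by
    rw [hw _ n.succ_pos, hP]
  have hw1' : ∀ n, w' (n + 1) = vg * (1 - vg) ^ n := fun n => by
    rw [hw' _ n.succ_pos, Nat.succ_sub_one]
  simp only [hw1, hw1', hP]
  exact ⟨hsum.abs, heq⟩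
end

section
/- Let λ ∈ (0,1) and β > 0 with (1−λ)β > 1. Then Σ_{n=1}^∞ (λβ)^{(n)}/β^{(n)} = λβ/((1−λ)β − 1), where x^{(n)} = x(x+1)⋯(x+n−1) is the rising factorial. -/
open Filter Topology in
theorem tendsto_prod_add_div_prod_add_zero {c b : ℝ} (hc : 0 < c) (hcb : c < b) :
    Tendsto (fun n : ℕ => (∏ i ∈ Finset.range (n + 1), (c + (i : ℝ))) /
      ∏ i ∈ Finset.range (n + 1), (b + (i : ℝ))) atTop (𝓝 0) := by
  have hb : 0 < b := hc.trans hcb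
  have hpow : Tendsto (fun n : ℕ => (n : ℝ) ^ (-(b - c))) atTop (𝓝 0) :=
    (tendsto_rpow_neg_atTop (sub_pos.2 hcb)).comp tendsto_natCast_atTop_atTop
  have hlim := (((Real.GammaSeq_tendsto_Gamma b).div (Real.GammaSeq_tendsto_Gamma c)
    (Real.Gamma_pos_of_pos hc).ne').mul hpow)
  rw [mul_zero] at hlim
  refine hlim.congr' ?_
  filter_upwards [eventually_gt_atTop 0] with n hn
  have hn' : (0 : ℝ) < n := Nat.cast_pos.2 hn
  have hprod {s : ℝ} (hs : 0 < s) : (∏ i ∈ Finset.range (n + 1), (s + (i : ℝ))) ≠ 0 :=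
    (Finset.prod_pos fun i _ => by positivity).ne'
  have hpc := hprod hc
  have hpb := hprod hb
  have hnb := (Real.rpow_pos_of_pos hn' b).ne'
  have hnc := (Real.rpow_pos_of_pos hn' c).ne'
  have hfac : (n.factorial : ℝ) ≠ 0 := Nat.cast_ne_zero.2 n.factorial_ne_zero
  simp only [Pi.div_apply, Real.GammaSeq]
  rw [neg_sub, Real.rpow_sub hn']
  field_simp

theorem sum_range_prod_add_div_prod_add {a b : ℝ} (hb : 0 < b) (hab : b - a - 1 ≠ 0) (n : ℕ) :
    ∑ k ∈ Finset.range n, (∏ i ∈ Finset.range (k + 1), (a + (i : ℝ))) /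
        ∏ i ∈ Finset.range (k + 1), (b + (i : ℝ)) =
      (a - (∏ i ∈ Finset.range (n + 1), (a + (i : ℝ))) /
        ∏ i ∈ Finset.range n, (b + (i : ℝ))) / (b - a - 1) := by
  induction n with
  | zero => simp
  | succ n ih =>
    have hpb : (∏ i ∈ Finset.range n, (b + (i : ℝ))) ≠ 0 :=
      (Finset.prod_pos fun i _ => by positivity).ne'
    have hbn : b + (n : ℝ) ≠ 0 := by positivity
    rw [Finset.sum_range_succ, ih, Finset.prod_range_succ _ (n + 1),
      Finset.prod_range_succ (fun i : ℕ => b + (i : ℝ)) n]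
    push_cast
    field_simp
    ring

/-- Let `λ ∈ (0,1)` and `β > 0` with `(1-λ)β > 1`. Then
`∑_{n=1}^∞ (λβ)^{(n)}/β^{(n)} = λβ/((1-λ)β - 1)`, where `x^{(n)} = x(x+1)⋯(x+n-1)` is
the rising factorial. (The term for `n : ℕ` is the term of index `n+1`.) -/
theorem sum_quotient_risingFactorial (lam β : ℝ) (hlam : lam ∈ Set.Ioo (0:ℝ) 1)
    (hβ : 0 < β) (h : 1 < (1 - lam) * β) :
    HasSum (fun n : ℕ =>
        (∏ i ∈ Finset.range (n + 1), (lam * β + (i : ℝ))) /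
          ∏ i ∈ Finset.range (n + 1), (β + (i : ℝ)))
      (lam * β / ((1 - lam) * β - 1)) := by
  have hl := hlam.1
  have ha : 0 < lam * β := mul_pos hl hβ
  have hab : 0 < β - lam * β - 1 := by linarith
  rw [hasSum_iff_tendsto_nat_of_nonneg fun n => by positivity]
  simp only [sum_range_prod_add_div_prod_add hβ hab.ne']
  rw [← Filter.tendsto_add_atTop_iff_nat 1]
  have hlim := (((tendsto_prod_add_div_prod_add_zero (c := lam * β + 1) (b := β)
    (by positivity) (by linarith)).const_mul (lam * β)).const_sub (lam * β)).div_const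
    (β - lam * β - 1)
  convert! hlim using 2 with n
  · rw [Finset.prod_range_succ' _ (n + 1)]
    push_cast
    simp only [add_zero, add_assoc, add_comm (1 : ℝ)]
    ring
  · ring
end
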